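/- arXiv:2405.17936 — 4 statements merged into one kernel-verified Lean document; each statement's English description precedes it below -/
import Mathlib

section
/- Let g : ℝ⁸ → ℝ⁸ be a linear map satisfying Φ₀(g(x), g(y), g(z), g(w)) = Φ₀(x, y, z, w) for all x, y, z, w ∈ ℝ⁸. Then g preserves the Euclidean inner product, i.e. ⟨g(x), g(y)⟩ = ⟨x, y⟩ for all x, y ∈ ℝ⁸, and det g = 1. (In other words, the stabilizer of the Cayley 4-form Φ₀ in GL(8,ℝ) is contained in SO(8): every element preserving Φ₀ preserves the Euclidean metric g₀ and the orientation of ℝ⁸.) -/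
noncomputable section
open scoped RealInnerProductSpace

/-- Euclidean 8-space ℝ⁸. -/
abbrev E8 : Type := EuclideanSpace ℝ (Fin 8)

/-- The alternating 4-form `dx^i ∧ dx^j ∧ dx^k ∧ dx^l` on ℝ⁸, evaluated on four vectors. -/
def dx4 (i j k l : Fin 8) (v : Fin 4 → E8) : ℝ :=
  Matrix.det (Matrix.of fun a b => v b (![i, j, k, l] a))

/-- The Cayley 4-form `Φ₀` on ℝ⁸ (indices written 0-based, i.e. `dx4 0 1 2 3` is `dx¹²³⁴`). -/
def Phi0 (v : Fin 4 → E8) : ℝ :=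
  dx4 0 1 2 3 v + dx4 0 1 4 5 v + dx4 0 1 6 7 v + dx4 0 2 4 6 v
    - dx4 0 2 5 7 v - dx4 0 3 4 7 v - dx4 0 3 5 6 v
    - dx4 1 2 4 7 v - dx4 1 2 5 6 v - dx4 1 3 4 6 v
    + dx4 1 3 5 7 v + dx4 2 3 4 5 v + dx4 2 3 6 7 v + dx4 4 5 6 7 v

open Equiv in
/-- A signed sum over permutations of `m ⊕ n`, weighted by the permutation matrix minor on `n`,
reduces to a signed sum over permutations of `m`. -/
theorem sum_sign_perm_sum {m n : Type*} [Fintype m] [DecidableEq m] [Fintype n] [DecidableEq n]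
    (F : (m → m ⊕ n) → ℝ) :
    ∑ σ : Perm (m ⊕ n), ((Perm.sign σ : ℤ) : ℝ) * (F (fun a => σ (Sum.inl a)) *
        Matrix.det (Matrix.of fun a b : n => if σ (Sum.inr b) = Sum.inr a then (1 : ℝ) else 0)) =
      (Fintype.card n).factorial *
        ∑ τ : Perm m, ((Perm.sign τ : ℤ) : ℝ) * F (fun a => Sum.inl (τ a)) := by
  have hdet (τ : Perm n) : Matrix.det (Matrix.of fun a b : n => if τ b = a then (1 : ℝ) else 0) =
      ((Perm.sign τ : ℤ) : ℝ) := by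
    rw [← Matrix.det_permutation τ, ← Matrix.det_transpose]
    congr 1
    ext a b
    simp [Equiv.toPEquiv, PEquiv.toMatrix_apply, eq_comm]
  rw [← Finset.sum_of_injOn (s := Finset.univ) (t := Finset.univ)
    (f := fun p : Perm m × Perm n => ((Perm.sign p.1 : ℤ) : ℝ) * F (fun a => Sum.inl (p.1 a)))
    (Perm.sumCongrHom m n) Perm.sumCongrHom_injective.injOn (by simp)]
  · rw [Fintype.sum_prod_type]
    simp [Fintype.card_perm, Finset.mul_sum]
  · intro σ _ hσ
    have hmaps : ¬ Set.MapsTo σ (Set.range Sum.inr) (Set.range Sum.inr) := fun h => hσ <| by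
      obtain ⟨p, hp⟩ := Perm.mem_sumCongrHom_range_of_perm_mapsTo_inl
        ((Perm.perm_mapsTo_inl_iff_mapsTo_inr σ).mpr h)
      exact ⟨p, by simp, hp⟩
    simp only [Set.MapsTo, Set.mem_range, forall_exists_index, forall_apply_eq_imp_iff,
      not_forall, not_exists] at hmaps
    obtain ⟨b, hb⟩ := hmaps
    rw [Matrix.det_eq_zero_of_column_eq_zero b fun a => by simpa using fun h => hb a h.symm]
    simp
  · rintro ⟨τ₁, τ₂⟩ -
    have hsq : ((Perm.sign τ₂ : ℤ) : ℝ) * ((Perm.sign τ₂ : ℤ) : ℝ) = 1 := by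
      rcases Int.units_eq_one_or (Perm.sign τ₂) with h | h <;> simp [h]
    simp only [Perm.sumCongrHom_apply, Perm.sumCongr_apply, Sum.map_inl, Sum.map_inr,
      Sum.inr.injEq, hdet, Perm.sign_sumCongr, Units.val_mul, Int.cast_mul]
    linear_combination (-((Perm.sign τ₁ : ℤ) : ℝ) * F (fun a => Sum.inl (τ₁ a))) * hsq

set_option maxHeartbeats 2000000 in
open Equiv in
/-- The antisymmetrization of `ω ⊗ ω` for an antisymmetric `ω` is eight times a Pfaffian. -/
theorem sum_sign_perm_fin_four (ω : Fin 8 → Fin 8 → ℝ) (hω : ∀ a b, ω b a = -ω a b)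
    (p : Fin 4 → Fin 8) :
    ∑ τ : Perm (Fin 4), ((Perm.sign τ : ℤ) : ℝ) *
        (ω (p (τ 0)) (p (τ 1)) * ω (p (τ 2)) (p (τ 3))) =
      8 * (ω (p 0) (p 1) * ω (p 2) (p 3) - ω (p 0) (p 2) * ω (p 1) (p 3)
        + ω (p 0) (p 3) * ω (p 1) (p 2)) := by
  have h₂ (q : Fin 4) (e : Perm (Fin 3)) :
      Perm.decomposeFin.symm (q, e) 2 = swap 0 q (e 1).succ :=
    Perm.decomposeFin_symm_apply_succ e q 1
  have h₃ (q : Fin 4) (e : Perm (Fin 3)) :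
      Perm.decomposeFin.symm (q, e) 3 = swap 0 q (e 2).succ :=
    Perm.decomposeFin_symm_apply_succ e q 2
  have h₂' (q : Fin 3) (e : Perm (Fin 2)) :
      Perm.decomposeFin.symm (q, e) 2 = swap 0 q (e 1).succ :=
    Perm.decomposeFin_symm_apply_succ e q 1
  simp only [Finset.univ_perm_fin_succ, Finset.sum_map, ← Finset.univ_product_univ,
    Finset.sum_product, Fin.sum_univ_succ]
  simp [Perm.decomposeFin_symm_apply_one, h₂, h₃, h₂', swap_apply_def]
  rw [hω (p 0) (p 1), hω (p 0) (p 2), hω (p 0) (p 3), hω (p 1) (p 2), hω (p 1) (p 3),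
    hω (p 2) (p 3)]
  ring

/-- The Cayley form `Phi0` as a bundled alternating map. -/
def cayleyForm : E8 [⋀^Fin 4]→ₗ[ℝ] ℝ :=
  let d (i j k l : Fin 8) : E8 [⋀^Fin 4]→ₗ[ℝ] ℝ :=
    Matrix.detRowAlternating.compLinearMap
      (LinearMap.pi fun a => (EuclideanSpace.proj (𝕜 := ℝ) (![i, j, k, l] a)).toLinearMap)
  d 0 1 2 3 + d 0 1 4 5 + d 0 1 6 7 + d 0 2 4 6
    - d 0 2 5 7 - d 0 3 4 7 - d 0 3 5 6
    - d 1 2 4 7 - d 1 2 5 6 - d 1 3 4 6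
    + d 1 3 5 7 + d 2 3 4 5 + d 2 3 6 7 + d 4 5 6 7

theorem cayleyForm_apply (v : Fin 4 → E8) : cayleyForm v = Phi0 v := by
  have h (i j k l : Fin 8) : Matrix.detRowAlternating.compLinearMap
      (LinearMap.pi fun a => (EuclideanSpace.proj (𝕜 := ℝ) (![i, j, k, l] a)).toLinearMap) v =
      dx4 i j k l v := by
    rw [dx4, ← Matrix.det_transpose]
    rfl
  simp [cayleyForm, Phi0, h]

/-- The 2-form `Φ₀(v, w, ·, ·)`. -/
def contraction (v w : E8) : E8 [⋀^Fin 2]→ₗ[ℝ] ℝ := (cayleyForm.curryLeft v).curryLeft w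

theorem contraction_apply (v w : E8) (x : Fin 2 → E8) :
    contraction v w x = Phi0 ![v, w, x 0, x 1] := by
  rw [contraction, AlternatingMap.curryLeft_apply_apply, AlternatingMap.curryLeft_apply_apply,
    cayleyForm_apply]
  congr 1
  ext i; fin_cases i <;> rfl

/-- The multilinear map `Φ₀(v, w, ·, ·) ⊗ Φ₀(v, w, ·, ·) ⊗ Φ₀`. -/
def wedgeTerm (v w : E8) : MultilinearMap ℝ (fun _ : Fin 4 ⊕ Fin 4 => E8) ℝ :=
  ((LinearMap.mul' ℝ ℝ).compMultilinearMap
    (((LinearMap.mul' ℝ ℝ).compMultilinearMap ((contraction v w).toMultilinearMap.domCoprod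
      (contraction v w).toMultilinearMap)).domCoprod cayleyForm.toMultilinearMap)).domDomCongr
      (finSumFinEquiv.sumCongr (Equiv.refl (Fin 4)))

theorem wedgeTerm_apply (v w : E8) (u : Fin 4 ⊕ Fin 4 → E8) :
    wedgeTerm v w u = Phi0 ![v, w, u (.inl 0), u (.inl 1)] *
      Phi0 ![v, w, u (.inl 2), u (.inl 3)] * Phi0 (fun k => u (.inr k)) := by
  rw [← cayleyForm_apply fun k => u (.inr k)]
  simp only [wedgeTerm, MultilinearMap.domDomCongr_apply, LinearMap.compMultilinearMap_apply,
    MultilinearMap.domCoprod_apply, LinearMap.mul'_apply, AlternatingMap.coe_multilinearMap,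
    contraction_apply]
  have h₀ : (finSumFinEquiv (.inl 0 : Fin 2 ⊕ Fin 2) : Fin (2 + 2)) = (0 : Fin 4) := rfl
  have h₁ : (finSumFinEquiv (.inl 1 : Fin 2 ⊕ Fin 2) : Fin (2 + 2)) = (1 : Fin 4) := rfl
  have h₂ : (finSumFinEquiv (.inr 0 : Fin 2 ⊕ Fin 2) : Fin (2 + 2)) = (2 : Fin 4) := rfl
  have h₃ : (finSumFinEquiv (.inr 1 : Fin 2 ⊕ Fin 2) : Fin (2 + 2)) = (3 : Fin 4) := rfl
  simp only [Equiv.sumCongr_apply, Sum.map_inl, Sum.map_inr, Equiv.refl_apply, h₀, h₁, h₂, h₃]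

/-- The 8-form obtained by antisymmetrizing `wedgeTerm v w`; up to a constant it is
`(w ⌟ v ⌟ Φ₀) ∧ (w ⌟ v ⌟ Φ₀) ∧ Φ₀`. -/
def wedge (v w : E8) : E8 [⋀^Fin 4 ⊕ Fin 4]→ₗ[ℝ] ℝ :=
  MultilinearMap.alternatization (wedgeTerm v w)

theorem wedge_apply (v w : E8) (u : Fin 4 ⊕ Fin 4 → E8) :
    wedge v w u = ∑ σ : Equiv.Perm (Fin 4 ⊕ Fin 4), ((Equiv.Perm.sign σ : ℤ) : ℝ) *
      (Phi0 ![v, w, u (σ (.inl 0)), u (σ (.inl 1))] *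
        Phi0 ![v, w, u (σ (.inl 2)), u (σ (.inl 3))] * Phi0 (fun k => u (σ (.inr k)))) := by
  rw [wedge, MultilinearMap.alternatization_apply]
  refine Finset.sum_congr rfl fun σ _ => ?_
  rw [MultilinearMap.domDomCongr_apply, wedgeTerm_apply, Units.smul_def, zsmul_eq_mul]

/-- The standard basis of ℝ⁸, indexed by `Fin 4 ⊕ Fin 4`. -/
def sumBasis : Module.Basis (Fin 4 ⊕ Fin 4) ℝ E8 :=
  (EuclideanSpace.basisFun (Fin 8) ℝ).toBasis.reindex (finSumFinEquiv (m := 4) (n := 4)).symm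

theorem sumBasis_apply (i : Fin 4 ⊕ Fin 4) :
    sumBasis i = EuclideanSpace.single (finSumFinEquiv i : Fin 8) (1 : ℝ) := by
  simp [sumBasis]

open Equiv in
theorem sum_sign_mul_dx4 (ω : Fin 8 → Fin 8 → ℝ) (hω : ∀ a b, ω b a = -ω a b)
    (ρ : Perm (Fin 8)) (hρ : Perm.sign ρ = 1) :
    ∑ σ : Perm (Fin 4 ⊕ Fin 4), ((Perm.sign σ : ℤ) : ℝ) *
      (ω (finSumFinEquiv (σ (.inl 0))) (finSumFinEquiv (σ (.inl 1))) *
        ω (finSumFinEquiv (σ (.inl 2))) (finSumFinEquiv (σ (.inl 3))) *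
        dx4 (ρ 4) (ρ 5) (ρ 6) (ρ 7) (fun k => sumBasis (σ (.inr k)))) =
    192 * (ω (ρ 0) (ρ 1) * ω (ρ 2) (ρ 3) - ω (ρ 0) (ρ 2) * ω (ρ 1) (ρ 3)
        + ω (ρ 0) (ρ 3) * ω (ρ 1) (ρ 2)) := by
  set σ₀ : Perm (Fin 4 ⊕ Fin 4) := finSumFinEquiv.symm.permCongr ρ with hσ₀
  have hsign : Perm.sign σ₀ = 1 := by rw [hσ₀, Perm.sign_permCongr, hρ]
  have hval (i : Fin 4 ⊕ Fin 4) : finSumFinEquiv (σ₀ i) = ρ (finSumFinEquiv i) := by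
    simp [hσ₀, Equiv.permCongr_apply]
  have key := sum_sign_perm_sum (m := Fin 4) (n := Fin 4) fun f =>
    ω (finSumFinEquiv (σ₀ (f 0))) (finSumFinEquiv (σ₀ (f 1))) *
      ω (finSumFinEquiv (σ₀ (f 2))) (finSumFinEquiv (σ₀ (f 3)))
  have pf := sum_sign_perm_fin_four ω hω fun a => finSumFinEquiv (σ₀ (.inl a))
  simp only [hval] at key pf
  rw [pf] at key
  rw [← Equiv.sum_comp (Equiv.mulLeft σ₀)]
  convert key using 1
  · refine Finset.sum_congr rfl fun σ _ => ?_
    simp only [Equiv.coe_mulLeft, Perm.sign_mul, hsign, one_mul, Perm.mul_apply, hval]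
    congr 2
    rw [dx4]
    congr 1
    ext a b
    have hI : ![ρ 4, ρ 5, ρ 6, ρ 7] a = ρ (finSumFinEquiv (.inr a)) := by
      fin_cases a <;> rfl
    simp [sumBasis_apply, hI, hval, eq_comm]
  · simp only [Fintype.card_fin, Nat.factorial]
    simp
    ring_nf
    rfl

theorem dx4_vec (i j k l : Fin 8) (v w x y : E8) :
    dx4 i j k l ![v, w, x, y] =
      (v i * w j - v j * w i) * (x k * y l - x l * y k)
      - (v i * w k - v k * w i) * (x j * y l - x l * y j)
      + (v i * w l - v l * w i) * (x j * y k - x k * y j)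
      + (v j * w k - v k * w j) * (x i * y l - x l * y i)
      - (v j * w l - v l * w j) * (x i * y k - x k * y i)
      + (v k * w l - v l * w k) * (x i * y j - x j * y i) := by
  simp only [dx4, Matrix.det_succ_row_zero, Fin.sum_univ_succ]
  simp [Fin.succAbove]
  ring

/-- The pairing of `ω ∧ ω` with `Φ₀`, for `ω = Φ₀(v, w, ·, ·)`, is a multiple of the Gram
determinant of `v` and `w`. -/
theorem sum_pfaffian_eq_gram (v w : E8) (ω : Fin 8 → Fin 8 → ℝ) (h : ∀ a b, ω a b =
    Phi0 ![v, w, EuclideanSpace.single a 1, EuclideanSpace.single b 1]) :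
    (ω 4 5 * ω 6 7 - ω 4 6 * ω 5 7 + ω 4 7 * ω 5 6)
      + (ω 2 3 * ω 6 7 - ω 2 6 * ω 3 7 + ω 2 7 * ω 3 6)
      + (ω 2 3 * ω 4 5 - ω 2 4 * ω 3 5 + ω 2 5 * ω 3 4)
      + (ω 1 3 * ω 5 7 - ω 1 5 * ω 3 7 + ω 1 7 * ω 3 5)
      - (ω 1 3 * ω 4 6 - ω 1 4 * ω 3 6 + ω 1 6 * ω 3 4)
      - (ω 1 2 * ω 5 6 - ω 1 5 * ω 2 6 + ω 1 6 * ω 2 5)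
      - (ω 1 2 * ω 4 7 - ω 1 4 * ω 2 7 + ω 1 7 * ω 2 4)
      - (ω 0 3 * ω 5 6 - ω 0 5 * ω 3 6 + ω 0 6 * ω 3 5)
      - (ω 0 3 * ω 4 7 - ω 0 4 * ω 3 7 + ω 0 7 * ω 3 4)
      - (ω 0 2 * ω 5 7 - ω 0 5 * ω 2 7 + ω 0 7 * ω 2 5)
      + (ω 0 2 * ω 4 6 - ω 0 4 * ω 2 6 + ω 0 6 * ω 2 4)
      + (ω 0 1 * ω 6 7 - ω 0 6 * ω 1 7 + ω 0 7 * ω 1 6)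
      + (ω 0 1 * ω 4 5 - ω 0 4 * ω 1 5 + ω 0 5 * ω 1 4)
      + (ω 0 1 * ω 2 3 - ω 0 2 * ω 1 3 + ω 0 3 * ω 1 2) = 3 * (⟪v, v⟫ * ⟪w, w⟫ - ⟪v, w⟫ ^ 2) := by
  have hinner (x y : E8) : ⟪x, y⟫ = ∑ i, x i * y i := by
    simp [PiLp.inner_apply, mul_comm]
  rw [hinner, hinner, hinner]
  simp [h, Phi0, dx4_vec, Fin.sum_univ_eight]
  ring

open Equiv in
theorem sum_sign_mul_Phi0 (ω : Fin 8 → Fin 8 → ℝ) (hω : ∀ a b, ω b a = -ω a b) :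
    ∑ σ : Perm (Fin 4 ⊕ Fin 4), ((Perm.sign σ : ℤ) : ℝ) *
      (ω (finSumFinEquiv (σ (.inl 0))) (finSumFinEquiv (σ (.inl 1))) *
        ω (finSumFinEquiv (σ (.inl 2))) (finSumFinEquiv (σ (.inl 3))) *
        Phi0 (fun k => sumBasis (σ (.inr k)))) = 192 * (
      (ω 4 5 * ω 6 7 - ω 4 6 * ω 5 7 + ω 4 7 * ω 5 6)
      + (ω 2 3 * ω 6 7 - ω 2 6 * ω 3 7 + ω 2 7 * ω 3 6)
      + (ω 2 3 * ω 4 5 - ω 2 4 * ω 3 5 + ω 2 5 * ω 3 4)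
      + (ω 1 3 * ω 5 7 - ω 1 5 * ω 3 7 + ω 1 7 * ω 3 5)
      - (ω 1 3 * ω 4 6 - ω 1 4 * ω 3 6 + ω 1 6 * ω 3 4)
      - (ω 1 2 * ω 5 6 - ω 1 5 * ω 2 6 + ω 1 6 * ω 2 5)
      - (ω 1 2 * ω 4 7 - ω 1 4 * ω 2 7 + ω 1 7 * ω 2 4)
      - (ω 0 3 * ω 5 6 - ω 0 5 * ω 3 6 + ω 0 6 * ω 3 5)
      - (ω 0 3 * ω 4 7 - ω 0 4 * ω 3 7 + ω 0 7 * ω 3 4)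
      - (ω 0 2 * ω 5 7 - ω 0 5 * ω 2 7 + ω 0 7 * ω 2 5)
      + (ω 0 2 * ω 4 6 - ω 0 4 * ω 2 6 + ω 0 6 * ω 2 4)
      + (ω 0 1 * ω 6 7 - ω 0 6 * ω 1 7 + ω 0 7 * ω 1 6)
      + (ω 0 1 * ω 4 5 - ω 0 4 * ω 1 5 + ω 0 5 * ω 1 4)
      + (ω 0 1 * ω 2 3 - ω 0 2 * ω 1 3 + ω 0 3 * ω 1 2)) := by
  have h0 := sum_sign_mul_dx4 ω hω
    ⟨![4, 5, 6, 7, 0, 1, 2, 3], ![4, 5, 6, 7, 0, 1, 2, 3], by decide, by decide⟩ (by decide)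
  have h1 := sum_sign_mul_dx4 ω hω
    ⟨![2, 3, 6, 7, 0, 1, 4, 5], ![4, 5, 0, 1, 6, 7, 2, 3], by decide, by decide⟩ (by decide)
  have h2 := sum_sign_mul_dx4 ω hω
    ⟨![2, 3, 4, 5, 0, 1, 6, 7], ![4, 5, 0, 1, 2, 3, 6, 7], by decide, by decide⟩ (by decide)
  have h3 := sum_sign_mul_dx4 ω hω
    ⟨![1, 3, 5, 7, 0, 2, 4, 6], ![4, 0, 5, 1, 6, 2, 7, 3], by decide, by decide⟩ (by decide)
  have h4 := sum_sign_mul_dx4 ω hω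
    ⟨![1, 3, 4, 6, 0, 2, 5, 7], ![4, 0, 5, 1, 2, 6, 3, 7], by decide, by decide⟩ (by decide)
  have h5 := sum_sign_mul_dx4 ω hω
    ⟨![1, 2, 5, 6, 0, 3, 4, 7], ![4, 0, 1, 5, 6, 2, 3, 7], by decide, by decide⟩ (by decide)
  have h6 := sum_sign_mul_dx4 ω hω
    ⟨![1, 2, 4, 7, 0, 3, 5, 6], ![4, 0, 1, 5, 2, 6, 7, 3], by decide, by decide⟩ (by decide)
  have h7 := sum_sign_mul_dx4 ω hω
    ⟨![0, 3, 5, 6, 1, 2, 4, 7], ![0, 4, 5, 1, 6, 2, 3, 7], by decide, by decide⟩ (by decide)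
  have h8 := sum_sign_mul_dx4 ω hω
    ⟨![0, 3, 4, 7, 1, 2, 5, 6], ![0, 4, 5, 1, 2, 6, 7, 3], by decide, by decide⟩ (by decide)
  have h9 := sum_sign_mul_dx4 ω hω
    ⟨![0, 2, 5, 7, 1, 3, 4, 6], ![0, 4, 1, 5, 6, 2, 7, 3], by decide, by decide⟩ (by decide)
  have h10 := sum_sign_mul_dx4 ω hω
    ⟨![0, 2, 4, 6, 1, 3, 5, 7], ![0, 4, 1, 5, 2, 6, 3, 7], by decide, by decide⟩ (by decide)
  have h11 := sum_sign_mul_dx4 ω hω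
    ⟨![0, 1, 6, 7, 2, 3, 4, 5], ![0, 1, 4, 5, 6, 7, 2, 3], by decide, by decide⟩ (by decide)
  have h12 := sum_sign_mul_dx4 ω hω
    ⟨![0, 1, 4, 5, 2, 3, 6, 7], ![0, 1, 4, 5, 2, 3, 6, 7], by decide, by decide⟩ (by decide)
  have h13 := sum_sign_mul_dx4 ω hω
    ⟨![0, 1, 2, 3, 4, 5, 6, 7], ![0, 1, 2, 3, 4, 5, 6, 7], by decide, by decide⟩ (by decide)
  simp only [Equiv.coe_fn_mk, Matrix.cons_val] at h0 h1 h2 h3 h4 h5 h6 h7 h8 h9 h10 h11 h12 h13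
  simp only [Phi0, mul_add, mul_sub, Finset.sum_add_distrib, Finset.sum_sub_distrib,
    h0, h1, h2, h3, h4, h5, h6, h7, h8, h9, h10, h11, h12, h13]

theorem wedge_sumBasis (v w : E8) :
    wedge v w sumBasis = 576 * (⟪v, v⟫ * ⟪w, w⟫ - ⟪v, w⟫ ^ 2) := by
  let ω (a b : Fin 8) : ℝ :=
    Phi0 ![v, w, EuclideanSpace.single a 1, EuclideanSpace.single b 1]
  have hω (a b : Fin 8) : ω b a = -ω a b := by
    have := (contraction v w).map_swap ![EuclideanSpace.single a 1, EuclideanSpace.single b 1]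
      (i := 0) (j := 1) (by decide)
    simpa [contraction_apply] using this
  have hsum := sum_sign_mul_Phi0 ω hω
  rw [sum_pfaffian_eq_gram v w ω fun _ _ => rfl] at hsum
  rw [wedge_apply]
  simp only [ω] at hsum
  simp only [sumBasis_apply] at hsum ⊢
  rw [hsum]
  ring

/-- A linear map preserving `Φ₀` scales Gram determinants of pairs by the inverse of its
determinant. -/
theorem gram_mul_det (g : E8 →ₗ[ℝ] E8)
    (hg : ∀ x y z w : E8, Phi0 ![g x, g y, g z, g w] = Phi0 ![x, y, z, w]) (v w : E8) :
    (⟪g v, g v⟫ * ⟪g w, g w⟫ - ⟪g v, g w⟫ ^ 2) * LinearMap.det g =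
      ⟪v, v⟫ * ⟪w, w⟫ - ⟪v, w⟫ ^ 2 := by
  have hg' (u : Fin 4 → E8) : Phi0 (fun k => g (u k)) = Phi0 u := by
    have h := hg (u 0) (u 1) (u 2) (u 3)
    have hu : ![u 0, u 1, u 2, u 3] = u := by ext i; fin_cases i <;> rfl
    have hgu : ![g (u 0), g (u 1), g (u 2), g (u 3)] = fun k => g (u k) := by
      ext i; fin_cases i <;> rfl
    rwa [hu, hgu] at h
  have hinv : wedge (g v) (g w) (g ∘ sumBasis) = wedge v w sumBasis := by
    simp only [wedge_apply, Function.comp_apply, hg, hg']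
  have hdet (f : E8 [⋀^Fin 4 ⊕ Fin 4]→ₗ[ℝ] ℝ) :
      f (g ∘ sumBasis) = f sumBasis * LinearMap.det g := by
    conv_lhs => rw [f.eq_smul_basis_det sumBasis]
    rw [AlternatingMap.smul_apply, Module.Basis.det_comp, Module.Basis.det_self, mul_one,
      smul_eq_mul]
  rw [hdet, wedge_sumBasis, wedge_sumBasis] at hinv
  linarith

/-- A symmetric 3×3 matrix whose adjugate is `d⁻¹` times the identity has vanishing
off-diagonal entries and equal diagonal entries. -/
theorem diagonal_of_minors {d a₁₁ a₂₂ a₃₃ a₁₂ a₁₃ a₂₃ : ℝ}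
    (h₁₃ : (a₁₁ * a₃₃ - a₁₃ ^ 2) * d = 1)
    (h₂₃ : (a₂₂ * a₃₃ - a₂₃ ^ 2) * d = 1)
    (h₁ : (a₁₁ * a₂₃ - a₁₂ * a₁₃) * d = 0) (h₂ : (a₂₂ * a₁₃ - a₁₂ * a₂₃) * d = 0)
    (h₃ : (a₃₃ * a₁₂ - a₁₃ * a₂₃) * d = 0) : a₁₂ = 0 ∧ a₁₁ = a₂₂ := by
  constructor
  · linear_combination (-a₁₂) * h₁₃ + a₁₁ * h₃ + a₁₃ * h₁
  · linear_combination (-a₁₁) * h₂₃ + a₂₂ * h₁₃ + a₁₃ * h₂ - a₂₃ * h₁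

/-- A linear map scaling all Gram determinants of pairs by the same factor is conformal. -/
theorem exists_inner_map_map_eq_smul {g : E8 →ₗ[ℝ] E8} {d : ℝ}
    (h : ∀ v w : E8, (⟪g v, g v⟫ * ⟪g w, g w⟫ - ⟪g v, g w⟫ ^ 2) * d =
      ⟪v, v⟫ * ⟪w, w⟫ - ⟪v, w⟫ ^ 2) :
    ∃ c : ℝ, ∀ x y : E8, ⟪g x, g y⟫ = c * ⟪x, y⟫ := by
  let e := EuclideanSpace.basisFun (Fin 8) ℝ
  have he (i j : Fin 8) : ⟪e i, e j⟫ = if i = j then 1 else 0 :=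
    orthonormal_iff_ite.mp e.orthonormal i j
  have hdiag {i j : Fin 8} (hij : i ≠ j) : (⟪g (e i), g (e i)⟫ * ⟪g (e j), g (e j)⟫ -
      ⟪g (e i), g (e j)⟫ ^ 2) * d = 1 := by
    rw [h]
    simp only [he, hij, if_true, if_false]
    norm_num
  have hmixed {i j k : Fin 8} (hij : i ≠ j) (hik : i ≠ k) (hjk : j ≠ k) :
      (⟪g (e i), g (e i)⟫ * ⟪g (e j), g (e k)⟫ -
        ⟪g (e i), g (e j)⟫ * ⟪g (e i), g (e k)⟫) * d = 0 := by
    have hjk' := h (e i) (e j + e k)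
    simp only [map_add, inner_add_left, inner_add_right, he, hij, hik, hjk, hjk.symm,
      if_true, if_false] at hjk'
    rw [real_inner_comm (g (e j)) (g (e k))] at hjk'
    linear_combination hjk' / 2 - hdiag hij / 2 - hdiag hik / 2
  have key {i j : Fin 8} (hij : i ≠ j) :
      ⟪g (e i), g (e j)⟫ = 0 ∧ ⟪g (e i), g (e i)⟫ = ⟪g (e j), g (e j)⟫ := by
    obtain ⟨k, hki, hkj⟩ : ∃ k : Fin 8, k ≠ i ∧ k ≠ j := by
      revert i j; decide
    refine diagonal_of_minors (hdiag hki.symm) (hdiag hkj.symm)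
      (hmixed hij hki.symm hkj.symm) ?_ ?_
    · have := hmixed hij.symm hkj.symm hki.symm
      rwa [real_inner_comm (g (e i)) (g (e j))] at this
    · have := hmixed hki hkj hij
      rwa [real_inner_comm (g (e i)) (g (e k)), real_inner_comm (g (e j)) (g (e k))] at this
  refine ⟨⟪g (e 0), g (e 0)⟫, fun x y => ?_⟩
  have hext : (innerₗ E8).compl₁₂ g g = ⟪g (e 0), g (e 0)⟫ • innerₗ E8 := by
    refine LinearMap.ext_basis e.toBasis e.toBasis fun i j => ?_
    by_cases hij : i = j
    · subst hij
      by_cases h0 : i = 0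
      · simp [h0]
      · simpa [he] using (key h0).2
    · simp [he, hij, (key hij).1]
  simpa using LinearMap.congr_fun₂ hext x y

/-- Any linear map `g : ℝ⁸ → ℝ⁸` preserving the Cayley 4-form `Φ₀`
preserves the Euclidean inner product and has determinant one; that is, the stabilizer
of `Φ₀` in `GL(8,ℝ)` is contained in `SO(8)`. -/
theorem cayley_stabilizer_subset_SO8 (g : E8 →ₗ[ℝ] E8)
    (hg : ∀ x y z w : E8, Phi0 ![g x, g y, g z, g w] = Phi0 ![x, y, z, w]) :
    (∀ x y : E8, ⟪g x, g y⟫ = ⟪x, y⟫) ∧ LinearMap.det g = 1 := by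
  obtain ⟨c, hc⟩ := exists_inner_map_map_eq_smul (gram_mul_det g hg)
  have he (i j : Fin 8) : ⟪(EuclideanSpace.single i 1 : E8), EuclideanSpace.single j 1⟫ =
      if i = j then 1 else 0 :=
    orthonormal_iff_ite.mp (EuclideanSpace.orthonormal_single (𝕜 := ℝ)) i j
  have hcd : c ^ 2 * LinearMap.det g = 1 := by
    have := gram_mul_det g hg (EuclideanSpace.single 0 1) (EuclideanSpace.single 1 1)
    simp only [hc, he, if_true, Fin.zero_eq_one_iff] at this
    norm_num at this
    linarith
  have hc0 : 0 ≤ c := by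
    have := hc (EuclideanSpace.single 0 1) (EuclideanSpace.single 0 1)
    rw [he, if_pos rfl, mul_one] at this
    exact this ▸ real_inner_self_nonneg
  have hdet : LinearMap.det g ^ 2 = c ^ 8 := by
    have hadj : g.adjoint ∘ₗ g = c • LinearMap.id := by
      refine LinearMap.ext fun x => ext_inner_right ℝ fun y => ?_
      simp [LinearMap.adjoint_inner_left, hc, inner_smul_left]
    have := congrArg LinearMap.det hadj
    have hadj_det : LinearMap.det g.adjoint = LinearMap.det g := by
      let e := EuclideanSpace.basisFun (Fin 8) ℝ
      rw [← LinearMap.det_toMatrix e.toBasis, LinearMap.toMatrix_adjoint e e,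
        Matrix.det_conjTranspose, LinearMap.det_toMatrix, star_trivial]
    rw [LinearMap.det_comp, hadj_det, LinearMap.det_smul] at this
    simpa [sq] using this
  have hc12 : c ^ 12 = 1 := by
    linear_combination (-c ^ 4) * hdet + (c ^ 2 * LinearMap.det g + 1) * hcd
  have hc1 : c = 1 := (pow_eq_one_iff_of_nonneg hc0 (by norm_num)).mp hc12
  subst hc1
  exact ⟨by simpa using hc, by simpa using hcd⟩
end
end

section
/- The Cayley 4-form Φ₀ is a calibration on ℝ⁸: for every orthonormal 4-tuple of vectors x₁, x₂, x₃, x₄ ∈ ℝ⁸ one has Φ₀(x₁, x₂, x₃, x₄) ≤ 1 (equivalently, the restriction of Φ₀ to any oriented 4-dimensional subspace is at most the volume form of that subspace). -/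
noncomputable section
open scoped RealInnerProductSpace

/-- Octonionic multiplication on ℝ⁸, with the first basis vector as unit. -/
def octMul (a b : E8) : E8 :=
  !₂[a 0 * b 0 - a 1 * b 1 - a 2 * b 2 - a 3 * b 3 - a 4 * b 4 - a 5 * b 5 - a 6 * b 6 - a 7 * b 7,
    a 0 * b 1 + a 1 * b 0 - a 2 * b 3 + a 3 * b 2 - a 4 * b 5 + a 5 * b 4 - a 6 * b 7 + a 7 * b 6,
    a 0 * b 2 + a 1 * b 3 + a 2 * b 0 - a 3 * b 1 - a 4 * b 6 + a 5 * b 7 + a 6 * b 4 - a 7 * b 5,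
    a 0 * b 3 - a 1 * b 2 + a 2 * b 1 + a 3 * b 0 + a 4 * b 7 + a 5 * b 6 - a 6 * b 5 - a 7 * b 4,
    a 0 * b 4 + a 1 * b 5 + a 2 * b 6 - a 3 * b 7 + a 4 * b 0 - a 5 * b 1 - a 6 * b 2 + a 7 * b 3,
    a 0 * b 5 - a 1 * b 4 - a 2 * b 7 - a 3 * b 6 + a 4 * b 1 + a 5 * b 0 + a 6 * b 3 + a 7 * b 2,
    a 0 * b 6 + a 1 * b 7 - a 2 * b 4 + a 3 * b 5 + a 4 * b 2 - a 5 * b 3 + a 6 * b 0 - a 7 * b 1,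
    a 0 * b 7 - a 1 * b 6 + a 2 * b 5 + a 3 * b 4 - a 4 * b 3 - a 5 * b 2 + a 6 * b 1 + a 7 * b 0]

/-- Octonionic conjugation on ℝ⁸. -/
def octConj (a : E8) : E8 :=
  !₂[a 0, -a 1, -a 2, -a 3, -a 4, -a 5, -a 6, -a 7]

lemma inner_eq_sum_eight (a b : E8) :
    ⟪a, b⟫ = a 0 * b 0 + a 1 * b 1 + a 2 * b 2 + a 3 * b 3 + a 4 * b 4 + a 5 * b 5
      + a 6 * b 6 + a 7 * b 7 := by
  simp [PiLp.inner_apply, Fin.sum_univ_eight, mul_comm]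

lemma norm_octMul (a b : E8) : ‖octMul a b‖ = ‖a‖ * ‖b‖ := by
  rw [← sq_eq_sq₀ (by positivity) (by positivity), mul_pow]
  simp only [← real_inner_self_eq_norm_sq, inner_eq_sum_eight]
  simp [octMul]
  ring

lemma norm_octConj (a : E8) : ‖octConj a‖ = ‖a‖ := by
  rw [← sq_eq_sq₀ (by positivity) (by positivity)]
  simp only [← real_inner_self_eq_norm_sq, inner_eq_sum_eight]
  simp [octConj]

lemma dx4_eq (i j k l : Fin 8) (v : Fin 4 → E8) :
    dx4 i j k l v =
      (v 0 i * v 1 j - v 0 j * v 1 i) * (v 2 k * v 3 l - v 2 l * v 3 k)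
      - (v 0 i * v 1 k - v 0 k * v 1 i) * (v 2 j * v 3 l - v 2 l * v 3 j)
      + (v 0 i * v 1 l - v 0 l * v 1 i) * (v 2 j * v 3 k - v 2 k * v 3 j)
      + (v 0 j * v 1 k - v 0 k * v 1 j) * (v 2 i * v 3 l - v 2 l * v 3 i)
      - (v 0 j * v 1 l - v 0 l * v 1 j) * (v 2 i * v 3 k - v 2 k * v 3 i)
      + (v 0 k * v 1 l - v 0 l * v 1 k) * (v 2 i * v 3 j - v 2 j * v 3 i) := by
  simp [dx4, Matrix.det_succ_row_zero, Fin.sum_univ_succ, Fin.succAbove]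
  ring

set_option maxHeartbeats 4000000 in
/-- The Cayley form is the alternating part of the octonionic triple product. -/
lemma Phi0_eq_inner_octMul (x : Fin 4 → E8) :
    Phi0 x = ⟪octMul (x 0) (octMul (octConj (x 1)) (x 2)), x 3⟫
      - ⟪x 0, x 1⟫ * ⟪x 2, x 3⟫ + ⟪x 0, x 2⟫ * ⟪x 1, x 3⟫ - ⟪x 1, x 2⟫ * ⟪x 0, x 3⟫ := by
  simp only [Phi0, dx4_eq, inner_eq_sum_eight]
  simp [octMul, octConj]
  ring

/-- The Cayley 4-form `Φ₀` is a calibration on ℝ⁸: its value on any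
orthonormal 4-tuple of vectors is at most `1`. -/
theorem cayley_form_is_calibration (x : Fin 4 → E8) (hx : Orthonormal ℝ x) :
    Phi0 x ≤ 1 := by
  rw [Phi0_eq_inner_octMul, hx.2 (by decide : (0 : Fin 4) ≠ 1),
    hx.2 (by decide : (0 : Fin 4) ≠ 2), hx.2 (by decide : (1 : Fin 4) ≠ 2)]
  simpa [norm_octMul, norm_octConj, hx.1] using
    real_inner_le_norm (octMul (x 0) (octMul (octConj (x 1)) (x 2))) (x 3)
end
end

section
/- For all u, v, z ∈ ℝ⁸, the squared norm of the vector J_{u,v}(z) equals the Gram determinant of (u, v, z): |J_{u,v}(z)|² = det [[⟨u,u⟩, ⟨u,v⟩, ⟨u,z⟩], [⟨v,u⟩, ⟨v,v⟩, ⟨v,z⟩], [⟨z,u⟩, ⟨z,v⟩, ⟨z,z⟩]]. (This is the identity |u × v × z| = |u ∧ v ∧ z| for the octonionic triple cross product.) -/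
noncomputable section
open scoped RealInnerProductSpace

/-- The `3 × 3` minor of `(u, v, z)` on the coordinates `i, j, k`. -/
def minor3 (u v z : E8) (i j k : Fin 8) : ℝ :=
  u i * (v j * z k - v k * z j) - u j * (v i * z k - v k * z i) + u k * (v i * z j - v j * z i)

lemma dx4_eq_minor3 (i j k l : Fin 8) (u v z w : E8) :
    dx4 i j k l ![u, v, z, w] =
      w l * minor3 u v z i j k - w k * minor3 u v z i j l
        + w j * minor3 u v z i k l - w i * minor3 u v z j k l := by
  simp [dx4, minor3, Matrix.det_succ_row_zero, Fin.sum_univ_succ, Fin.succAbove]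
  ring

/-- The triple cross product `u × v × z` in coordinates. -/
def tripleCross (u v z : E8) : Fin 8 → ℝ :=
  ![- minor3 u v z 1 2 3 - minor3 u v z 1 4 5 - minor3 u v z 1 6 7
      - minor3 u v z 2 4 6 + minor3 u v z 2 5 7 + minor3 u v z 3 4 7 + minor3 u v z 3 5 6,
    minor3 u v z 0 2 3 + minor3 u v z 0 4 5 + minor3 u v z 0 6 7 + minor3 u v z 2 4 7
      + minor3 u v z 2 5 6 + minor3 u v z 3 4 6 - minor3 u v z 3 5 7,
    - minor3 u v z 0 1 3 + minor3 u v z 0 4 6 - minor3 u v z 0 5 7 - minor3 u v z 1 4 7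
      - minor3 u v z 1 5 6 - minor3 u v z 3 4 5 - minor3 u v z 3 6 7,
    minor3 u v z 0 1 2 - minor3 u v z 0 4 7 - minor3 u v z 0 5 6 - minor3 u v z 1 4 6
      + minor3 u v z 1 5 7 + minor3 u v z 2 4 5 + minor3 u v z 2 6 7,
    - minor3 u v z 0 1 5 - minor3 u v z 0 2 6 + minor3 u v z 0 3 7 + minor3 u v z 1 2 7
      + minor3 u v z 1 3 6 - minor3 u v z 2 3 5 - minor3 u v z 5 6 7,
    minor3 u v z 0 1 4 + minor3 u v z 0 2 7 + minor3 u v z 0 3 6 + minor3 u v z 1 2 6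
      - minor3 u v z 1 3 7 + minor3 u v z 2 3 4 + minor3 u v z 4 6 7,
    - minor3 u v z 0 1 7 + minor3 u v z 0 2 4 - minor3 u v z 0 3 5 - minor3 u v z 1 2 5
      - minor3 u v z 1 3 4 - minor3 u v z 2 3 7 - minor3 u v z 4 5 7,
    minor3 u v z 0 1 6 - minor3 u v z 0 2 5 - minor3 u v z 0 3 4 - minor3 u v z 1 2 4
      + minor3 u v z 1 3 5 + minor3 u v z 2 3 6 + minor3 u v z 4 5 6]

lemma Phi0_eq_sum_tripleCross (u v z w : E8) :
    Phi0 ![u, v, z, w] = ∑ i, tripleCross u v z i * w i := by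
  simp only [Phi0, dx4_eq_minor3, tripleCross, Fin.sum_univ_eight, Matrix.cons_val]
  ring

set_option maxHeartbeats 4000000 in
lemma sum_sq_tripleCross (u v z : E8) :
    ∑ i, tripleCross u v z i ^ 2 =
      Matrix.det !![⟪u, u⟫, ⟪u, v⟫, ⟪u, z⟫;
                    ⟪v, u⟫, ⟪v, v⟫, ⟪v, z⟫;
                    ⟪z, u⟫, ⟪z, v⟫, ⟪z, z⟫] := by
  simp only [tripleCross, minor3, Matrix.det_fin_three, Matrix.of_apply, PiLp.inner_apply,
    RCLike.inner_apply, conj_trivial, Fin.sum_univ_eight, Matrix.cons_val]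
  ring

/-- For all `u, v, z ∈ ℝ⁸`, the squared norm of `J_{u,v}(z)` (where
`⟨J_{u,v} z, w⟩ = Φ₀(u,v,z,w)` for all `z, w`) equals the Gram determinant of `(u, v, z)`:
`|u × v × z| = |u ∧ v ∧ z|`. -/
theorem norm_sq_triple_cross_eq_gram_det (u v : E8) (J : E8 → E8)
    (hJ : ∀ z w : E8, ⟪J z, w⟫ = Phi0 ![u, v, z, w]) (z : E8) :
    ‖J z‖ ^ 2 =
      Matrix.det !![⟪u, u⟫, ⟪u, v⟫, ⟪u, z⟫;
                    ⟪v, u⟫, ⟪v, v⟫, ⟪v, z⟫;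
                    ⟪z, u⟫, ⟪z, v⟫, ⟪z, z⟫] := by
  have hcoord : ∀ i, J z i = tripleCross u v z i := fun i => by
    have h := hJ z (EuclideanSpace.single i 1)
    simpa [Phi0_eq_sum_tripleCross, EuclideanSpace.inner_single_right] using h
  rw [EuclideanSpace.real_norm_sq_eq, ← sum_sq_tripleCross]
  simp only [hcoord]
end
end

section
/- Let u, v, w ∈ ℝ⁸ be pairwise orthogonal unit vectors. Then the four vectors u, v, w, J_{u,v}(w) are orthonormal and Φ₀(u, v, w, J_{u,v}(w)) = 1; hence the 4-dimensional subspace span{u, v, w, J_{u,v}(w)} is a Cayley plane. In particular, every orthonormal 3-frame in ℝ⁸ extends to an orthonormal basis of a Cayley plane (the Cayley 4-frame {u, v, w, u×v×w}). -/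
noncomputable section
open scoped RealInnerProductSpace

/-- A Cayley plane: a 4-dimensional subspace of ℝ⁸ admitting an orthonormal basis on
which `Φ₀` evaluates to `1`. -/
def IsCayleyPlane (ξ : Submodule ℝ E8) : Prop :=
  ∃ x : Fin 4 → E8, Orthonormal ℝ x ∧ Submodule.span ℝ (Set.range x) = ξ ∧ Phi0 x = 1

/-- The 4-form `Φ₀` vanishes on quadruples with a repeated vector. -/
theorem Phi0_eq_zero_of_eq {x : Fin 4 → E8} {a b : Fin 4} (hab : a ≠ b) (h : x a = x b) :
    Phi0 x = 0 := by
  have hdx (i j k l : Fin 8) : dx4 i j k l x = 0 :=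
    Matrix.det_zero_of_column_eq hab fun c => by simp [h]
  simp [Phi0, hdx]

theorem dx4_apply (i j k l : Fin 8) (u v w x : E8) :
    dx4 i j k l ![u, v, w, x] =
      (v i * w j * u k + w i * u j * v k + u i * v j * w k
        - v i * u j * w k - u i * w j * v k - w i * v j * u k) * x l
      - (v i * w j * u l + w i * u j * v l + u i * v j * w l
        - v i * u j * w l - u i * w j * v l - w i * v j * u l) * x k
      + (v i * w k * u l + w i * u k * v l + u i * v k * w l
        - v i * u k * w l - u i * w k * v l - w i * v k * u l) * x j
      - (v j * w k * u l + w j * u k * v l + u j * v k * w l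
        - v j * u k * w l - u j * w k * v l - w j * v k * u l) * x i := by
  simp [dx4, Matrix.det_succ_row_zero, Fin.sum_univ_succ, Fin.succAbove]
  ring

/-- The triple cross product of three vectors has squared length their Gram determinant. -/
theorem sum_Phi0_single_sq (u v w : E8) :
    ∑ l, Phi0 ![u, v, w, EuclideanSpace.single l 1] ^ 2 =
      ⟪u, u⟫ * ⟪v, v⟫ * ⟪w, w⟫ + 2 * ⟪u, v⟫ * ⟪u, w⟫ * ⟪v, w⟫
        - ⟪u, u⟫ * ⟪v, w⟫ ^ 2 - ⟪v, v⟫ * ⟪u, w⟫ ^ 2 - ⟪w, w⟫ * ⟪u, v⟫ ^ 2 := by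
  simp only [Phi0, dx4_apply, Fin.sum_univ_eight, PiLp.inner_apply, PiLp.single_apply]
  simp
  ring

/-- If `u, v, w` are pairwise orthogonal unit vectors in ℝ⁸ then
`u, v, w, J_{u,v}(w)` is an orthonormal 4-frame with `Φ₀(u,v,w,J_{u,v}w) = 1`, so its
span is a Cayley plane: every orthonormal 3-frame extends to a Cayley 4-frame
`{u, v, w, u × v × w}`. -/
theorem orthonormal_three_frame_extends_to_cayley_plane (u v w : E8)
    (hu : ‖u‖ = 1) (hv : ‖v‖ = 1) (hw : ‖w‖ = 1)
    (huv : ⟪u, v⟫ = 0) (huw : ⟪u, w⟫ = 0) (hvw : ⟪v, w⟫ = 0)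
    (J : E8 → E8) (hJ : ∀ z w' : E8, ⟪J z, w'⟫ = Phi0 ![u, v, z, w']) :
    Orthonormal ℝ ![u, v, w, J w] ∧ Phi0 ![u, v, w, J w] = 1 ∧
      IsCayleyPlane (Submodule.span ℝ (Set.range ![u, v, w, J w])) := by
  have hnorm : ⟪J w, J w⟫ = 1 := by
    have hcoord (l : Fin 8) : J w l = Phi0 ![u, v, w, EuclideanSpace.single l 1] := by
      rw [← hJ, EuclideanSpace.inner_single_right]
      simp
    have hsq := sum_Phi0_single_sq u v w
    simp only [← hcoord, real_inner_self_eq_norm_sq, hu, hv, hw, huv, huw, hvw] at hsq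
    rw [real_inner_self_eq_norm_sq, EuclideanSpace.real_norm_sq_eq, hsq]
    norm_num
  have hJu : ⟪u, J w⟫ = 0 := by
    rw [real_inner_comm, hJ]
    exact Phi0_eq_zero_of_eq (a := 0) (b := 3) (by decide) rfl
  have hJv : ⟪v, J w⟫ = 0 := by
    rw [real_inner_comm, hJ]
    exact Phi0_eq_zero_of_eq (a := 1) (b := 3) (by decide) rfl
  have hJw : ⟪w, J w⟫ = 0 := by
    rw [real_inner_comm, hJ]
    exact Phi0_eq_zero_of_eq (a := 2) (b := 3) (by decide) rfl
  have hon : Orthonormal ℝ ![u, v, w, J w] := by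
    rw [orthonormal_iff_ite]
    intro i j
    fin_cases i <;> fin_cases j <;>
      simp [hu, hv, hw, huv, huw, hvw, hJu, hJv, hJw, hnorm, real_inner_comm u,
        real_inner_comm v, real_inner_comm w, real_inner_self_eq_norm_sq,
        -inner_self_eq_norm_sq_to_K]
  have hPhi : Phi0 ![u, v, w, J w] = 1 := by rw [← hJ, hnorm]
  exact ⟨hon, hPhi, _, hon, rfl, hPhi⟩
end
end
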